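/- Let m, n ∈ ℕ and let S = {e, x} be the two-element fusion ring with identity e, ordered by e < x, with fusion rule x*x = m·x + n·e (so m^x_{x,x} = m, m^e_{x,x} = n, m^s_{t,e} = m^s_{e,t} = δ_{s,t}, and m^e_{e,x} = m^e_{x,e} = m^x_{e,e} = 0). Then S^e_{x,x,x,x} ≡ C(n,2) + n·C(m,2) (mod 2), where C(n,2) = n(n−1)/2. -/

import Mathlib

open Finset

/-- The combinatorial quantity `S^x_{x₁,x₂,x₃,x₄}` of a linearly ordered fusion
ring with structural constants `c` (where `c x y z = m^x_{y,z}`): the sum of the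
five inversion-counting terms and the final binomial term, whose parity gives
the cocycle `α^x_{x₁,x₂,x₃,x₄} = (−1)^{S^x_{x₁,x₂,x₃,x₄}}` representing the
first obstruction to monoidality. -/
def obstructionSum {S : Type*} [Fintype S] [LinearOrder S]
    (c : S → S → S → ℕ) (x x₁ x₂ x₃ x₄ : S) : ℕ :=
  (∑ a : S, ∑ a' : S, ∑ b : S, ∑ b' : S,
    if a' < a ∧ b < b' then
      c x x₁ a * c a x₂ b * c b x₃ x₄ * (c x x₁ a' * c a' x₂ b' * c b' x₃ x₄)
    else 0) +
  (∑ cc : S, ∑ c' : S, ∑ b : S, ∑ b' : S,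
    if c' < cc ∧ b < b' then
      c x cc b * c cc x₁ x₂ * c b x₃ x₄ * (c x c' b' * c c' x₁ x₂ * c b' x₃ x₄)
    else 0) +
  (∑ a : S, ∑ a' : S, ∑ e : S, ∑ e' : S,
    if a' < a ∧ e < e' then
      c x x₁ a * c a e x₄ * c e x₂ x₃ * (c x x₁ a' * c a' e' x₄ * c e' x₂ x₃)
    else 0) +
  (∑ d : S, ∑ d' : S, ∑ e : S, ∑ e' : S,
    if d' < d ∧ e < e' then
      c x d x₄ * c d x₁ e * c e x₂ x₃ * (c x d' x₄ * c d' x₁ e' * c e' x₂ x₃)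
    else 0) +
  (∑ d : S, ∑ d' : S, ∑ cc : S, ∑ c' : S,
    if d' < d ∧ cc < c' then
      c x d x₄ * c d cc x₃ * c cc x₁ x₂ * (c x d' x₄ * c d' c' x₃ * c c' x₁ x₂)
    else 0) +
  (∑ cc : S, ∑ b : S,
    c x cc b * Nat.choose (c cc x₁ x₂) 2 * Nat.choose (c b x₃ x₄) 2)

/-- The structural constants of the two-element fusion ring `S = {e, x}`
(realized as `Fin 2` with `e = 0 < x = 1`) with identity `e` and fusion rule
`x*x = m·x + n·e`: `twoElemFusion m n s t u = m^s_{t,u}`. -/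
def twoElemFusion (m n : ℕ) : Fin 2 → Fin 2 → Fin 2 → ℕ :=
  fun s t u =>
    if t = 0 then (if s = u then 1 else 0)
    else if u = 0 then (if s = t then 1 else 0)
    else if s = 0 then n else m

/-- for the two-element fusion ring `{e, x}` with
`x*x = m·x + n·e`, one has `S^e_{x,x,x,x} ≡ C(n,2) + n·C(m,2) (mod 2)`. -/
theorem obstructionSum_e (m n : ℕ) :
    obstructionSum (twoElemFusion m n) 0 1 1 1 1 ≡
      Nat.choose n 2 + n * Nat.choose m 2 [MOD 2] := by
  have sq_modEq (k : ℕ) : k * k ≡ k [MOD 2] := by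
    rcases Nat.mod_two_eq_zero_or_one k with h | h <;> simp [Nat.ModEq, Nat.mul_mod, h]
  have sum_eq : obstructionSum (twoElemFusion m n) 0 1 1 1 1 =
      n.choose 2 * n.choose 2 + n * (m.choose 2 * m.choose 2) := by
    simp [obstructionSum, twoElemFusion, Fin.sum_univ_two, mul_assoc]
  rw [sum_eq]
  exact (sq_modEq _).add ((sq_modEq _).mul_left n)
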